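/- arXiv:2411.01488 — 2 statements merged into one kernel-verified Lean document; each statement's English description precedes it below -/
import Mathlib

section
/- Let B : ℝ → ℝ be the first-degree B-spline basis function, B(t) = max(0, 1−|t|). Let S be a finite index set, and for each s ∈ S let λ(s) ∈ ℝ be a coefficient, m(s) ∈ ℕ a scale level, and g(s) ∈ ℤ³ a grid point. Define f : ℝ³ → ℝ by f(v) = ∑_{s ∈ S} λ(s)·B((v₁−g(s)₁)/2^{m(s)})·B((v₂−g(s)₂)/2^{m(s)})·B((v₃−g(s)₃)/2^{m(s)}). Then for every n = (n₁,n₂,n₃) ∈ ℤ³ there exist coefficients c(i,j,k) ∈ ℝ for i,j,k ∈ {0,1} such that f(v) = ∑_{i,j,k ∈ {0,1}} c(i,j,k)·v₁^i·v₂^j·v₃^k for all v in the unit cell [n₁,n₁+1]×[n₂,n₂+1]×[n₃,n₃+1]; that is, f restricts to a trilinear polynomial on every finest-level grid cell. -/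
/-- The first-degree B-spline basis function `B(t) = max 0 (1 - |t|)`. -/
noncomputable def Bspline (t : ℝ) : ℝ := max 0 (1 - |t|)

theorem Bspline_of_nonneg {t : ℝ} (h₀ : 0 ≤ t) (h₁ : t ≤ 1) : Bspline t = 1 - t := by
  rw [Bspline, abs_of_nonneg h₀, max_eq_right (by linarith)]

theorem Bspline_of_nonpos {t : ℝ} (h₀ : t ≤ 0) (h₁ : -1 ≤ t) : Bspline t = 1 + t := by
  rw [Bspline, abs_of_nonpos h₀, max_eq_right (by linarith), sub_neg_eq_add]

theorem Bspline_of_one_le_abs {t : ℝ} (h : 1 ≤ |t|) : Bspline t = 0 :=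
  max_eq_left (by linarith)

/-- A first-degree B-spline with integer centre and positive integer half-width is affine on
every interval between consecutive integers. -/
theorem exists_Bspline_eq_affine {M : ℕ} (hM : 0 < M) (g n : ℤ) :
    ∃ a : Fin 2 → ℝ, ∀ t ∈ Set.Icc (n : ℝ) (n + 1),
      Bspline ((t - g) / M) = ∑ i, a i * t ^ (i : ℕ) := by
  have hM' : (0 : ℝ) < M := by exact_mod_cast hM
  obtain h | h | h | h : n + 1 ≤ g - M ∨ (g - M ≤ n ∧ n + 1 ≤ g) ∨
      (g ≤ n ∧ n + 1 ≤ g + M) ∨ g + M ≤ n := by omega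
  · have h' : (n : ℝ) + 1 ≤ g - M := by exact_mod_cast h
    refine ⟨![0, 0], fun t ht => ?_⟩
    rw [Bspline_of_one_le_abs]
    · simp
    · refine le_abs.2 (Or.inr ?_)
      rw [← neg_div, le_div_iff₀ hM']
      linarith [ht.2]
  · have h₁ : (g : ℝ) - M ≤ n := by exact_mod_cast h.1
    have h₂ : (n : ℝ) + 1 ≤ g := by exact_mod_cast h.2
    refine ⟨![1 - g / M, 1 / M], fun t ht => ?_⟩
    rw [Bspline_of_nonpos]
    · simp
      ring
    · exact div_nonpos_of_nonpos_of_nonneg (by linarith [ht.2]) hM'.le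
    · rw [le_div_iff₀ hM']
      linarith [ht.1]
  · have h₁ : (g : ℝ) ≤ n := by exact_mod_cast h.1
    have h₂ : (n : ℝ) + 1 ≤ g + M := by exact_mod_cast h.2
    refine ⟨![1 + g / M, -(1 / M)], fun t ht => ?_⟩
    rw [Bspline_of_nonneg]
    · simp
      ring
    · exact div_nonneg (by linarith [ht.1]) hM'.le
    · rw [div_le_iff₀ hM']
      linarith [ht.2]
  · have h' : (g : ℝ) + M ≤ n := by exact_mod_cast h
    refine ⟨![0, 0], fun t ht => ?_⟩
    rw [Bspline_of_one_le_abs]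
    · simp
    · refine le_abs.2 (Or.inl ?_)
      rw [le_div_iff₀ hM']
      linarith [ht.1]

/-- A finite linear combination of dyadically scaled, integer-shifted tensor-product
first-degree B-spline basis functions restricts to a trilinear polynomial on every
finest-level (unit) grid cell. -/
theorem Bspline_combination_trilinear_on_cell
    {ι : Type*} (S : Finset ι) (lam : ι → ℝ) (m : ι → ℕ) (g : ι → Fin 3 → ℤ)
    (f : (Fin 3 → ℝ) → ℝ)
    (hf : ∀ v : Fin 3 → ℝ,
      f v = ∑ s ∈ S, lam s * ∏ i : Fin 3, Bspline ((v i - (g s i : ℝ)) / 2 ^ (m s)))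
    (n : Fin 3 → ℤ) :
    ∃ c : Fin 2 → Fin 2 → Fin 2 → ℝ,
      ∀ v : Fin 3 → ℝ, (∀ i, v i ∈ Set.Icc ((n i : ℝ)) ((n i : ℝ) + 1)) →
        f v = ∑ i : Fin 2, ∑ j : Fin 2, ∑ k : Fin 2,
          c i j k * v 0 ^ (i : ℕ) * v 1 ^ (j : ℕ) * v 2 ^ (k : ℕ) := by
  choose a ha using fun s i => exists_Bspline_eq_affine (pow_pos two_pos (m s)) (g s i) (n i)
  push_cast at ha
  refine ⟨fun i j k => ∑ s ∈ S, lam s * (a s 0 i * a s 1 j * a s 2 k), fun v hv => ?_⟩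
  rw [hf]
  simp only [Finset.sum_mul, Fin.sum_univ_two, ← Finset.sum_add_distrib]
  refine Finset.sum_congr rfl fun s _ => ?_
  rw [Finset.prod_congr rfl fun i _ => ha s i (v i) (hv i)]
  simp only [Fin.prod_univ_three, Fin.sum_univ_two]
  ring
end

section
/- Let I be a finite nonempty index set; for each i ∈ I let v₁ⁱ, v₂ⁱ, v₃ⁱ ∈ ℝ³ be affinely independent, let Tᵢ = conv{v₁ⁱ, v₂ⁱ, v₃ⁱ}, and let M = ⋃_{i ∈ I} Tᵢ be the polygonal mesh surface. Let f : ℝ³ → ℝ be continuously differentiable, and for each i let C(Tᵢ) be the candidate set of f on Tᵢ. Then there exist points p_min, p_max ∈ ⋃_{i ∈ I} C(Tᵢ) such that, setting ε₁ = f(p_min) and ε₂ = f(p_max), one has ε₁ ≤ f(v) ≤ ε₂ for every v ∈ M, with ε₁ and ε₂ attained on M. Consequently the thin-shell region {x ∈ ℝ³ : ε₁ ≤ f(x) ≤ ε₂} rigorously contains the entire mesh M. -/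
/-- The candidate set of a function `f` on the triangle with vertices `v₁, v₂, v₃`:
(i) the vertices; (ii) points in an open edge segment where the directional derivative
along that edge vanishes; (iii) points of the triangle where both directional
derivatives `Df(p)(v₂ − v₁)` and `Df(p)(v₃ − v₁)` vanish. -/
def candidateSet (f : (Fin 3 → ℝ) → ℝ) (v₁ v₂ v₃ : Fin 3 → ℝ) : Set (Fin 3 → ℝ) :=
  {v₁, v₂, v₃} ∪
  {p | (p ∈ openSegment ℝ v₁ v₂ ∧ fderiv ℝ f p (v₂ - v₁) = 0) ∨
       (p ∈ openSegment ℝ v₁ v₃ ∧ fderiv ℝ f p (v₃ - v₁) = 0) ∨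
       (p ∈ openSegment ℝ v₂ v₃ ∧ fderiv ℝ f p (v₃ - v₂) = 0)} ∪
  {p | p ∈ convexHull ℝ {v₁, v₂, v₃} ∧
       fderiv ℝ f p (v₂ - v₁) = 0 ∧ fderiv ℝ f p (v₃ - v₁) = 0}

theorem mem_convexHull_triple_iff {E : Type*} [AddCommGroup E] [Module ℝ E] {x y z p : E} :
    p ∈ convexHull ℝ {x, y, z} ↔
      ∃ a b c : ℝ, 0 ≤ a ∧ 0 ≤ b ∧ 0 ≤ c ∧ a + b + c = 1 ∧ a • x + b • y + c • z = p := by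
  constructor
  · intro hp
    rw [convexHull_insert (Set.insert_nonempty _ _), convexHull_pair, mem_convexJoin] at hp
    obtain ⟨x', hx', q, ⟨b, c, hb, hc, hbc, rfl⟩, ⟨s, t, hs, ht, hst, rfl⟩⟩ := hp
    obtain rfl : x' = x := hx'
    refine ⟨s, t * b, t * c, hs, mul_nonneg ht hb, mul_nonneg ht hc, ?_, by module⟩
    linear_combination hst + t * hbc
  · rintro ⟨a, b, c, ha, hb, hc, habc, rfl⟩
    have h := (convex_convexHull ℝ ({x, y, z} : Set E)).sum_mem (t := Finset.univ)
      (w := ![a, b, c]) (z := ![x, y, z])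
      (by intro i _; fin_cases i <;> simpa)
      (by simpa [Fin.sum_univ_three] using habc)
      (by intro i _; apply subset_convexHull; fin_cases i <;> simp)
    simpa [Fin.sum_univ_three] using h

theorem IsExtrOn.fderiv_apply_eq_zero {E : Type*} [NormedAddCommGroup E] [NormedSpace ℝ E]
    {f : E → ℝ} {s : Set E} {p w : E} (h : IsExtrOn f s p) (hf : DifferentiableAt ℝ f p)
    (hw : ∀ᶠ t : ℝ in nhds 0, p + t • w ∈ s) : fderiv ℝ f p w = 0 := by
  have hd : HasDerivAt (fun t : ℝ => f (p + t • w)) (fderiv ℝ f p w) 0 :=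
    hf.hasFDerivAt.hasLineDerivAt w
  have hext : IsLocalExtr (fun t : ℝ => f (p + t • w)) 0 := by
    rcases h with h | h
    · left
      filter_upwards [hw] with t ht
      simpa using h ht
    · right
      filter_upwards [hw] with t ht
      simpa using h ht
  exact hext.hasDerivAt_eq_zero hd

theorem eventually_nonneg_add_mul {a : ℝ} (r : ℝ) (ha : 0 < a) :
    ∀ᶠ t : ℝ in nhds 0, 0 ≤ a + t * r := by
  have hc : ContinuousAt (fun t : ℝ => a + t * r) 0 := by fun_prop
  filter_upwards [hc.eventually_const_lt (by simpa using ha)] with t ht using ht.le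

theorem IsExtrOn.mem_candidateSet {f : (Fin 3 → ℝ) → ℝ} {v₁ v₂ v₃ p : Fin 3 → ℝ}
    (h : IsExtrOn f (convexHull ℝ {v₁, v₂, v₃}) p) (hp : p ∈ convexHull ℝ {v₁, v₂, v₃})
    (hf : DifferentiableAt ℝ f p) : p ∈ candidateSet f v₁ v₂ v₃ := by
  obtain ⟨a, b, c, ha, hb, hc, habc, hsum⟩ := mem_convexHull_triple_iff.1 hp
  have h₁₂ (ha : 0 < a) (hb : 0 < b) : fderiv ℝ f p (v₂ - v₁) = 0 := by
    refine h.fderiv_apply_eq_zero hf ?_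
    filter_upwards [eventually_nonneg_add_mul (-1) ha, eventually_nonneg_add_mul 1 hb]
      with t ht₁ ht₂
    refine mem_convexHull_triple_iff.2 ⟨_, _, c, ht₁, ht₂, hc, by linarith, ?_⟩
    rw [← hsum]
    module
  have h₁₃ (ha : 0 < a) (hc : 0 < c) : fderiv ℝ f p (v₃ - v₁) = 0 := by
    refine h.fderiv_apply_eq_zero hf ?_
    filter_upwards [eventually_nonneg_add_mul (-1) ha, eventually_nonneg_add_mul 1 hc]
      with t ht₁ ht₂
    refine mem_convexHull_triple_iff.2 ⟨_, b, _, ht₁, hb, ht₂, by linarith, ?_⟩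
    rw [← hsum]
    module
  have h₂₃ (hb : 0 < b) (hc : 0 < c) : fderiv ℝ f p (v₃ - v₂) = 0 := by
    refine h.fderiv_apply_eq_zero hf ?_
    filter_upwards [eventually_nonneg_add_mul (-1) hb, eventually_nonneg_add_mul 1 hc]
      with t ht₁ ht₂
    refine mem_convexHull_triple_iff.2 ⟨a, _, _, ha, ht₁, ht₂, by linarith, ?_⟩
    rw [← hsum]
    module
  rcases ha.eq_or_lt with rfl | ha <;> rcases hb.eq_or_lt with rfl | hb <;>
    rcases hc.eq_or_lt with rfl | hc
  · norm_num at habc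
  · obtain rfl : c = 1 := by linarith
    left; left; simp [← hsum]
  · obtain rfl : b = 1 := by linarith
    left; left; simp [← hsum]
  · left; right; right; right
    exact ⟨⟨b, c, hb, hc, by linarith, by simpa using hsum⟩, h₂₃ hb hc⟩
  · obtain rfl : a = 1 := by linarith
    left; left; simp [← hsum]
  · left; right; right; left
    exact ⟨⟨a, c, ha, hc, by linarith, by simpa using hsum⟩, h₁₃ ha hc⟩
  · left; right; left
    exact ⟨⟨a, b, ha, hb, by linarith, by simpa using hsum⟩, h₁₂ ha hb⟩
  · right
    exact ⟨hp, h₁₂ ha hb, h₁₃ ha hc⟩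

/-- For a `C¹` function `f` and a mesh `M` that is a finite union of nondegenerate
triangles, the extreme values `ε₁ = f(p_min)` and `ε₂ = f(p_max)` of `f` over `M` are
attained at candidate points of the triangles, and the thin-shell region
`{x : ε₁ ≤ f x ≤ ε₂}` rigorously contains `M`. -/
theorem thin_shell_wraps_mesh
    {ι : Type*} [Fintype ι] [Nonempty ι]
    (v₁ v₂ v₃ : ι → (Fin 3 → ℝ))
    (hind : ∀ i, AffineIndependent ℝ ![v₁ i, v₂ i, v₃ i])
    (f : (Fin 3 → ℝ) → ℝ) (hf : ContDiff ℝ 1 f)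
    (M : Set (Fin 3 → ℝ)) (hM : M = ⋃ i, convexHull ℝ {v₁ i, v₂ i, v₃ i}) :
    ∃ pmin pmax : Fin 3 → ℝ,
      pmin ∈ (⋃ i, candidateSet f (v₁ i) (v₂ i) (v₃ i)) ∧
      pmax ∈ (⋃ i, candidateSet f (v₁ i) (v₂ i) (v₃ i)) ∧
      pmin ∈ M ∧ pmax ∈ M ∧
      (∀ v ∈ M, f pmin ≤ f v ∧ f v ≤ f pmax) ∧
      M ⊆ {x : Fin 3 → ℝ | f pmin ≤ f x ∧ f x ≤ f pmax} := by
  have hcompact : IsCompact M := by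
    rw [hM]
    exact isCompact_iUnion fun i => (Set.toFinite _).isCompact_convexHull ℝ
  have hsub (i : ι) : convexHull ℝ {v₁ i, v₂ i, v₃ i} ⊆ M := by
    rw [hM]
    exact Set.subset_iUnion (fun i => convexHull ℝ {v₁ i, v₂ i, v₃ i}) i
  have hne : M.Nonempty := by
    obtain ⟨i⟩ := ‹Nonempty ι›
    exact ⟨v₁ i, hsub i (subset_convexHull ℝ _ (by simp))⟩
  have hcand {p : Fin 3 → ℝ} (hp : p ∈ M) (h : IsExtrOn f M p) :
      p ∈ ⋃ i, candidateSet f (v₁ i) (v₂ i) (v₃ i) := by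
    have hp' := hp
    rw [hM] at hp'
    obtain ⟨i, hi⟩ := Set.mem_iUnion.1 hp'
    exact Set.mem_iUnion.2 ⟨i, (h.on_subset (hsub i)).mem_candidateSet hi
      (hf.differentiable one_ne_zero p)⟩
  obtain ⟨pmin, hmin, hminOn⟩ := hcompact.exists_isMinOn hne hf.continuous.continuousOn
  obtain ⟨pmax, hmax, hmaxOn⟩ := hcompact.exists_isMaxOn hne hf.continuous.continuousOn
  exact ⟨pmin, pmax, hcand hmin (Or.inl hminOn), hcand hmax (Or.inr hmaxOn), hmin, hmax,
    fun v hv => ⟨hminOn hv, hmaxOn hv⟩, fun v hv => ⟨hminOn hv, hmaxOn hv⟩⟩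
end
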